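/- Let n ≥ 1 and let Ω ⊆ 𝕆_sⁿ be an axially symmetric slice-domain. A function f : Ω → 𝕆 is weak slice regular if and only if it is strong slice regular. -/

import Mathlib

/-! Octonions via the Cayley–Dickson construction on the quaternions,
the n-dimensional quadratic cone, the slice topology, and slice regularity. -/

noncomputable section
open Quaternion Topology

/-- The octonions, as `ℍ × ℍ` with the (L²) Euclidean norm and
Cayley–Dickson multiplication. -/
abbrev Oct : Type := WithLp 2 (ℍ × ℍ)

namespace Oct

def c1 (p : Oct) : ℍ := (WithLp.equiv 2 (ℍ × ℍ) p).1
def c2 (p : Oct) : ℍ := (WithLp.equiv 2 (ℍ × ℍ) p).2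
def mk (a b : ℍ) : Oct := (WithLp.equiv 2 (ℍ × ℍ)).symm (a, b)

instance : One Oct := ⟨mk 1 0⟩

/-- Cayley–Dickson multiplication. -/
instance : Mul Oct :=
  ⟨fun p q => mk (c1 p * c1 q - star (c2 q) * c2 p) (c2 q * c1 p + c2 p * star (c1 q))⟩

/-- Octonionic conjugation. -/
instance : Star Oct := ⟨fun p => mk (star (c1 p)) (-(c2 p))⟩

/-- Inverse: `p⁻¹ = ‖p‖⁻² • (star p)` (so `0⁻¹ = 0`). -/
instance : Inv Oct := ⟨fun p => (‖p‖ ^ 2)⁻¹ • star p⟩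

/-- The real inner product on `𝕆 ≅ ℝ⁸`, via polarization. -/
def oinner (p q : Oct) : ℝ := (1 / 4) * (‖p + q‖ ^ 2 - ‖p - q‖ ^ 2)

/-- The sphere `𝕊` of imaginary units of the octonions. -/
def Sph : Set Oct := {I | I * I = -1}

/-- The slice complex plane `ℂ_I = ℝ + ℝ I ⊆ 𝕆`. -/
def CI (I : Oct) : Set Oct := {z | ∃ s t : ℝ, z = s • (1 : Oct) + t • I}

end Oct

open Oct

/-- The point `x + y I ∈ ℂ_Iⁿ ⊆ 𝕆ⁿ`. -/
def aff {n : ℕ} (x y : Fin n → ℝ) (I : Oct) : Fin n → Oct :=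
  fun m => x m • (1 : Oct) + y m • I

/-- The embedding `ℝⁿ ⊆ 𝕆ⁿ`. -/
def ofRealn {n : ℕ} (x : Fin n → ℝ) : Fin n → Oct := fun m => x m • (1 : Oct)

/-- The slice `ℂ_Iⁿ ⊆ 𝕆ⁿ`. -/
def slicen (n : ℕ) (I : Oct) : Set (Fin n → Oct) := {q | ∃ x y : Fin n → ℝ, q = aff x y I}

/-- The `n`-dimensional quadratic cone `𝕆ₛⁿ = ⋃_{I ∈ 𝕊} ℂ_Iⁿ`. -/
def cone (n : ℕ) : Set (Fin n → Oct) := ⋃ I ∈ Sph, slicen n I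

/-- The slice topology `τ_s`: a set is open iff its trace on every slice `ℂ_Iⁿ`
is open (expressed via the canonical parametrizations `(x,y) ↦ x + yI`). -/
def τs (n : ℕ) : TopologicalSpace (Fin n → Oct) :=
  ⨆ I : Sph, TopologicalSpace.coinduced
    (fun p : (Fin n → ℝ) × (Fin n → ℝ) => aff p.1 p.2 I.1) inferInstance

/-- A slice-open subset of the quadratic cone. -/
def SliceOpen (n : ℕ) (Ω : Set (Fin n → Oct)) : Prop :=
  Ω ⊆ cone n ∧ IsOpen[τs n] Ω

/-- A slice-domain: a nonempty slice-connected slice-open subset of the cone. -/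
def SliceDomain (n : ℕ) (Ω : Set (Fin n → Oct)) : Prop :=
  SliceOpen n Ω ∧ @IsConnected _ (τs n) Ω

/-- Real-connectedness: `Ω ∩ ℝⁿ` is a (pre)connected subset of `ℝⁿ`. -/
def RealConnected (n : ℕ) (Ω : Set (Fin n → Oct)) : Prop :=
  IsPreconnected {x : Fin n → ℝ | ofRealn x ∈ Ω}

/-- Axially symmetric subsets of the cone. -/
def AxSymm (n : ℕ) (Ω : Set (Fin n → Oct)) : Prop :=
  ∀ (x y : Fin n → ℝ), ∀ I ∈ Sph, ∀ J ∈ Sph, aff x y I ∈ Ω → aff x y J ∈ Ω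

/-- The upper half-space `ℝ²ⁿ₊`: pairs `(x,y)` with `y = 0` or the first
nonzero coordinate of `y` positive. -/
def pos2n (n : ℕ) : Set ((Fin n → ℝ) × (Fin n → ℝ)) :=
  {p | p.2 = 0 ∨ ∃ m : Fin n, 0 < p.2 m ∧ ∀ k : Fin n, k < m → p.2 k = 0}

/-- `Ω_{s₁}`. -/
def s1 {n : ℕ} (Ω : Set (Fin n → Oct)) : Set ((Fin n → ℝ) × (Fin n → ℝ)) :=
  {p | ∃ I ∈ Sph, aff p.1 p.2 I ∈ Ω}

/-- `Ω_{s₂}`. -/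
def s2 {n : ℕ} (Ω : Set (Fin n → Oct)) : Set ((Fin n → ℝ) × (Fin n → ℝ)) :=
  {p | ∃ J ∈ Sph, ∃ K ∈ Sph, J ≠ K ∧ aff p.1 p.2 J ∈ Ω ∧ aff p.1 p.2 K ∈ Ω}

/-- Slice functions: induced on `Ω_{s₂}⁺` by a pair `(F₁, F₂)` via
`f(x + yI) = F₁(x,y) + I·F₂(x,y)`. -/
def IsSliceFun (n : ℕ) (Ω : Set (Fin n → Oct)) (f : (Fin n → Oct) → Oct) : Prop :=
  ∃ F₁ F₂ : (Fin n → ℝ) × (Fin n → ℝ) → Oct,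
    ∀ x y : Fin n → ℝ, (x, y) ∈ s2 Ω ∩ pos2n n → ∀ I ∈ Sph, aff x y I ∈ Ω →
      f (aff x y I) = F₁ (x, y) + I * F₂ (x, y)

/-- Holomorphy of a function of `n` slice variables, read through the
parametrization `(x,y) ↦ x + yI`: continuous partial derivatives (i.e. `C¹`)
and the Cauchy–Riemann equations `(∂/∂xₘ + I ∂/∂yₘ) g = 0` on `U`. -/
def Holo (n : ℕ) (I : Oct) (g : (Fin n → ℝ) × (Fin n → ℝ) → Oct)
    (U : Set ((Fin n → ℝ) × (Fin n → ℝ))) : Prop :=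
  ContDiffOn ℝ 1 g U ∧
  ∀ p ∈ U, ∀ m : Fin n,
    fderiv ℝ g p (Pi.single m 1, 0) + I * fderiv ℝ g p (0, Pi.single m 1) = 0

/-- Weak slice regularity: each restriction `f|_{Ω ∩ ℂ_Iⁿ}` is holomorphic. -/
def WSliceReg (n : ℕ) (Ω : Set (Fin n → Oct)) (f : (Fin n → Oct) → Oct) : Prop :=
  ∀ I ∈ Sph, Holo n I (fun p => f (aff p.1 p.2 I)) {p | aff p.1 p.2 I ∈ Ω}

/-- The complex structure `σ(a,b) = (−b,a)` on `𝕆²`. -/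
def sigma2 : Oct × Oct → Oct × Oct := fun w => (-w.2, w.1)

/-- Holomorphic stem maps: `F : V → 𝕆²` extends to a `C¹` map `G` on an open
neighborhood `U ⊇ V` satisfying `(∂/∂xₘ + σ ∂/∂yₘ) G = 0` on `U`. -/
def StemHolo (n : ℕ) (V : Set ((Fin n → ℝ) × (Fin n → ℝ)))
    (F : (Fin n → ℝ) × (Fin n → ℝ) → Oct × Oct) : Prop :=
  ∃ (U : Set ((Fin n → ℝ) × (Fin n → ℝ))) (G : (Fin n → ℝ) × (Fin n → ℝ) → Oct × Oct),
    IsOpen U ∧ V ⊆ U ∧ Set.EqOn G F V ∧ ContDiffOn ℝ 1 G U ∧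
    ∀ p ∈ U, ∀ m : Fin n,
      fderiv ℝ G p (Pi.single m 1, 0) + sigma2 (fderiv ℝ G p (0, Pi.single m 1)) = 0

/-- Strong slice regularity: `f` is induced by a holomorphic stem map on `Ω_{s₁}`. -/
def SSliceReg (n : ℕ) (Ω : Set (Fin n → Oct)) (f : (Fin n → Oct) → Oct) : Prop :=
  ∃ F : (Fin n → ℝ) × (Fin n → ℝ) → Oct × Oct, StemHolo n (s1 Ω) F ∧
    ∀ x y : Fin n → ℝ, ∀ I ∈ Sph, aff x y I ∈ Ω →
      f (aff x y I) = (F (x, y)).1 + I * (F (x, y)).2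

/-- An s-basis `{I, J, K}` of the octonions. -/
def IsSBasis (I J K : Oct) : Prop :=
  I ∈ Sph ∧ J ∈ Sph ∧ K ∈ Sph ∧
  LinearIndependent ℝ ![(1 : Oct), I, J, I * J, K, J * K, I * K, (I * J) * K] ∧
  Submodule.span ℝ (Set.range ![(1 : Oct), I, J, I * J, K, J * K, I * K, (I * J) * K]) = ⊤

/-- Iterated left multiplication `L_w^β = (L_{w₁})^{β₁} ∘ ⋯ ∘ (L_{wₙ})^{βₙ}`. -/
def Lpow {n : ℕ} (w : Fin n → Oct) (β : Fin n → ℕ) : Oct → Oct :=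
  fun a => (List.finRange n).foldr (fun ℓ c => (fun o => w ℓ * o)^[β ℓ] c) a

/-- The `*`-power `(q − p)^{*α} a = ∑_{β ≤ α} C(α,β) L_q^β (L_{−p}^{α−β} a)`. -/
def starPow {n : ℕ} (p : Fin n → Oct) (α : Fin n → ℕ) (a : Oct) (q : Fin n → Oct) : Oct :=
  ∑ β ∈ Finset.Iic α, (∏ ℓ, (α ℓ).choose (β ℓ)) • Lpow q β (Lpow (-p) (α - β) a)

/-- The `ℓ`-th slice derivative `∂_ℓ f (x + w) = (∂/∂x_ℓ) f (x + w)`. -/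
def sderiv {n : ℕ} (ℓ : Fin n) (f : (Fin n → Oct) → Oct) : (Fin n → Oct) → Oct :=
  fun q => deriv (fun t : ℝ => f (fun m => q m + (if m = ℓ then t else 0) • (1 : Oct))) 0

/-- The iterated slice derivative `f^{(α)} = (∂₁)^{α₁} ⋯ (∂ₙ)^{αₙ} f`. -/
def sderivMulti {n : ℕ} (α : Fin n → ℕ) (f : (Fin n → Oct) → Oct) : (Fin n → Oct) → Oct :=
  (List.finRange n).foldr (fun ℓ g => (sderiv ℓ)^[α ℓ] g) f

/-- The slice-polydisc `P̃(q₀, r)` (relative to `I ∈ 𝕊` with `q₀ ∈ ℂ_Iⁿ`):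
points `x + yJ` with `x ± yI` in the closed polydisc `P_I(q₀, r)`. -/
def polyDisc {n : ℕ} (q₀ : Fin n → Oct) (I : Oct) (r : Fin n → ℝ) : Set (Fin n → Oct) :=
  {q | ∃ x y : Fin n → ℝ, ∃ J ∈ Sph, q = aff x y J ∧
        (∀ ℓ, ‖aff x y I ℓ - q₀ ℓ‖ ≤ r ℓ) ∧ (∀ ℓ, ‖aff x (-y) I ℓ - q₀ ℓ‖ ≤ r ℓ)}

namespace Oct

@[ext] theorem ext' {p q : Oct} (h₁ : c1 p = c1 q) (h₂ : c2 p = c2 q) : p = q :=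
  (WithLp.equiv 2 (ℍ × ℍ)).injective (Prod.ext h₁ h₂)

@[simp] theorem c1_mk (a b : ℍ) : c1 (mk a b) = a := rfl
@[simp] theorem c2_mk (a b : ℍ) : c2 (mk a b) = b := rfl
@[simp] theorem c1_add (p q : Oct) : c1 (p + q) = c1 p + c1 q := rfl
@[simp] theorem c2_add (p q : Oct) : c2 (p + q) = c2 p + c2 q := rfl
@[simp] theorem c1_neg (p : Oct) : c1 (-p) = -c1 p := rfl
@[simp] theorem c2_neg (p : Oct) : c2 (-p) = -c2 p := rfl
@[simp] theorem c1_smul (t : ℝ) (p : Oct) : c1 (t • p) = t • c1 p := rfl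
@[simp] theorem c2_smul (t : ℝ) (p : Oct) : c2 (t • p) = t • c2 p := rfl
@[simp] theorem c1_zero : c1 0 = 0 := rfl
@[simp] theorem c2_zero : c2 0 = 0 := rfl
@[simp] theorem c1_one : c1 1 = 1 := rfl
@[simp] theorem c2_one : c2 1 = 0 := rfl
@[simp] theorem c1_mul (p q : Oct) : c1 (p * q) = c1 p * c1 q - star (c2 q) * c2 p := rfl
@[simp] theorem c2_mul (p q : Oct) : c2 (p * q) = c2 q * c1 p + c2 p * star (c1 q) := rfl

theorem left_alternative (p q : Oct) : p * (p * q) = (p * p) * q := by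
  ext <;> simp <;> ring

/-- Left multiplication as a continuous real-linear map. -/
def mulLeft (p : Oct) : Oct →L[ℝ] Oct :=
  LinearMap.toContinuousLinearMap
    { toFun := fun q => p * q
      map_add' := fun q r => by ext <;> simp <;> ring
      map_smul' := fun t q => by ext <;> simp <;> ring }

@[simp] theorem mulLeft_apply (p q : Oct) : mulLeft p q = p * q := rfl

theorem mul_mul_of_mem_Sph {I : Oct} (hI : I ∈ Sph) (q : Oct) : I * (I * q) = -q := by
  rw [left_alternative, show I * I = -1 from hI]
  ext <;> simp

theorem neg_mul_eq (p q : Oct) : -p * q = -(p * q) := by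
  ext <;> simp <;> ring

theorem neg_mem_Sph {I : Oct} (hI : I ∈ Sph) : -I ∈ Sph := by
  change -I * -I = -1
  rw [← show I * I = -1 from hI]
  ext <;> simp

theorem re_eq_zero_of_mem_Sph {I : Oct} (hI : I ∈ Sph) : (c1 I).re = 0 := by
  have h : I * I = -1 := hI
  have e1 := congrArg c1 h
  have e2 := congrArg c2 h
  simp only [Quaternion.ext_iff] at e1 e2
  simp at e1 e2
  obtain ⟨a, b, c, d⟩ := e1
  obtain ⟨a', b', c', d'⟩ := e2
  by_contra h0
  have key : ∀ v : ℝ, (c1 I).re * v = 0 → v = 0 := fun v hv =>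
    (mul_eq_zero.1 hv).resolve_left h0
  have k1 := key _ (show (c1 I).re * (c1 I).imI = 0 by linarith)
  have k2 := key _ (show (c1 I).re * (c1 I).imJ = 0 by linarith)
  have k3 := key _ (show (c1 I).re * (c1 I).imK = 0 by linarith)
  have k4 := a'.resolve_right h0
  have k5 := key _ (show (c1 I).re * (c2 I).imI = 0 by linarith)
  have k6 := key _ (show (c1 I).re * (c2 I).imJ = 0 by linarith)
  have k7 := key _ (show (c1 I).re * (c2 I).imK = 0 by linarith)
  simp only [k1, k2, k3, k4, k5, k6, k7] at a
  nlinarith [mul_self_nonneg (c1 I).re]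

theorem eq_or_eq_neg_of_smul_eq {I J : Oct} (hI : I ∈ Sph) (hJ : J ∈ Sph) {s t : ℝ}
    (h : s • J = t • I) : s = 0 ∧ t = 0 ∨ J = I ∧ s = t ∨ J = -I ∧ s = -t := by
  have hI' : I * I = -1 := hI
  have hJ' : J * J = -1 := hJ
  have hsq : s ^ 2 = t ^ 2 := by
    have h1 : (s • J) * (s • J) = (s ^ 2) • (J * J) := by ext <;> simp <;> ring
    have h2 : (t • I) * (t • I) = (t ^ 2) • (I * I) := by ext <;> simp <;> ring
    have h3 : (s ^ 2) • (-1 : Oct) = (t ^ 2) • (-1 : Oct) := by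
      rw [← hJ', ← h1, h, h2, hI', hJ']
    simpa using congrArg (fun p => (c1 p).re) h3
  by_cases hs : s = 0
  · left
    subst hs
    exact ⟨rfl, by simpa using hsq.symm⟩
  · right
    rcases sq_eq_sq_iff_eq_or_eq_neg.1 hsq with rfl | rfl
    · exact Or.inl ⟨smul_right_injective _ hs h, rfl⟩
    · refine Or.inr ⟨?_, rfl⟩
      have : (-t) • J = (-t) • (-I) := by rw [h]; simp
      exact smul_right_injective _ hs this

theorem mk_zero_mem_Sph {a : ℍ} (h₀ : a.re = 0)
    (h₁ : a.imI ^ 2 + a.imJ ^ 2 + a.imK ^ 2 = 1) : mk a 0 ∈ Sph := by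
  have ha : a * a = -1 := by
    ext <;> simp [h₀]
    · linarith
    all_goals ring
  exact ext' (by rw [c1_mul]; simp only [c1_mk, c2_mk, ha]; simp) (by rw [c2_mul]; simp)

theorem ne_neg_of_mem_Sph {I : Oct} (hI : I ∈ Sph) : I ≠ -I := fun e => by
  have h2 : (2 : ℝ) • I = 0 := by
    rw [two_smul]
    nth_rewrite 2 [e]
    exact add_neg_cancel I
  have h3 : I * I = -1 := hI
  rw [(smul_eq_zero.1 h2).resolve_left two_ne_zero] at h3
  simpa using congrArg (fun p => (c1 p).re) h3

theorem exists_mem_Sph_ne (I : Oct) : ∃ J ∈ Sph, J ≠ I ∧ J ≠ -I := by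
  have hi : mk ⟨0, 1, 0, 0⟩ 0 ∈ Sph := mk_zero_mem_Sph rfl (by simp)
  have hj : mk ⟨0, 0, 1, 0⟩ 0 ∈ Sph := mk_zero_mem_Sph rfl (by simp)
  by_cases h : (c1 I).imI = 0
  · refine ⟨_, hi, fun e => ?_, fun e => ?_⟩
    · have h1 : 1 = (c1 I).imI := congrArg (fun p => (c1 p).imI) e
      exact one_ne_zero (h1.trans h)
    · have h1 : 1 = -(c1 I).imI := congrArg (fun p => (c1 p).imI) e
      simp [h] at h1
  · refine ⟨_, hj, fun e => h ?_, fun e => h ?_⟩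
    · exact (congrArg (fun p => (c1 p).imI) e).symm
    · have h1 : 0 = -(c1 I).imI := congrArg (fun p => (c1 p).imI) e
      exact neg_eq_zero.1 h1.symm

end Oct

theorem aff_neg {n : ℕ} (x y : Fin n → ℝ) (I : Oct) : aff x y (-I) = aff x (-y) I := by
  funext m
  simp [aff]

theorem aff_zero {n : ℕ} (x : Fin n → ℝ) (I J : Oct) : aff x 0 I = aff x 0 J := by
  funext m
  simp [aff]

theorem eq_of_aff_eq_aff {n : ℕ} {x y x' y' : Fin n → ℝ} {I J : Oct} (hI : I ∈ Sph)
    (hJ : J ∈ Sph) (h : aff x y J = aff x' y' I) :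
    x = x' ∧ (y' = 0 ∨ J = I ∧ y = y' ∨ J = -I ∧ y = -y') := by
  have hx : x = x' := by
    funext m
    simpa [aff, re_eq_zero_of_mem_Sph hI, re_eq_zero_of_mem_Sph hJ] using
      congrArg (fun p => (c1 p).re) (congrFun h m)
  subst hx
  refine ⟨rfl, ?_⟩
  have hy : ∀ m, y m • J = y' m • I := fun m => add_left_cancel (congrFun h m)
  by_cases h0 : y' = 0
  · exact Or.inl h0
  right
  obtain ⟨m, hm⟩ := Function.ne_iff.1 h0
  rcases eq_or_eq_neg_of_smul_eq hI hJ (hy m) with ⟨-, h2⟩ | ⟨rfl, -⟩ | ⟨rfl, -⟩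
  · exact absurd h2 hm
  · refine Or.inl ⟨rfl, funext fun k => ?_⟩
    rcases eq_or_eq_neg_of_smul_eq hI hJ (hy k) with ⟨h1, h2⟩ | ⟨-, h1⟩ | ⟨h1, -⟩
    · rw [h1, h2]
    · exact h1
    · exact absurd h1 (ne_neg_of_mem_Sph hI)
  · refine Or.inr ⟨rfl, funext fun k => ?_⟩
    rcases eq_or_eq_neg_of_smul_eq hI hJ (hy k) with ⟨h1, h2⟩ | ⟨h1, -⟩ | ⟨-, h1⟩
    · simp [h1, h2]
    · exact absurd h1.symm (ne_neg_of_mem_Sph hI)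
    · exact h1

theorem isOpen_τs_iff {n : ℕ} {A : Set (Fin n → Oct)} :
    IsOpen[τs n] A ↔ ∀ I ∈ Sph,
      IsOpen {p : (Fin n → ℝ) × (Fin n → ℝ) | aff p.1 p.2 I ∈ A} := by
  rw [τs, isOpen_iSup_iff]
  simp only [isOpen_coinduced, Subtype.forall]
  rfl

theorem setOf_aff_mem_eq_s1 {n : ℕ} {Ω : Set (Fin n → Oct)} (hax : AxSymm n Ω) {I : Oct}
    (hI : I ∈ Sph) : {p : (Fin n → ℝ) × (Fin n → ℝ) | aff p.1 p.2 I ∈ Ω} = s1 Ω :=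
  Set.ext fun p => ⟨fun h => ⟨I, hI, h⟩, fun ⟨J, hJ, h⟩ => hax p.1 p.2 J hJ I hI h⟩

theorem isOpen_s1 {n : ℕ} {Ω : Set (Fin n → Oct)} (hΩ : SliceOpen n Ω) (hax : AxSymm n Ω)
    {I : Oct} (hI : I ∈ Sph) : IsOpen (s1 Ω) :=
  setOf_aff_mem_eq_s1 hax hI ▸ isOpen_τs_iff.1 hΩ.2 I hI

/-- In an axially symmetric slice-domain, a relatively clopen part of a single slice that contains
no real points is empty. -/
theorem eq_empty_of_relatively_clopen {n : ℕ} {Ω : Set (Fin n → Oct)} (hΩ : SliceDomain n Ω)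
    (hax : AxSymm n Ω) {I : Oct} (hI : I ∈ Sph) {W : Set ((Fin n → ℝ) × (Fin n → ℝ))}
    (hW : IsOpen W) (hWΩ : W ⊆ s1 Ω) (hd : IsOpen (s1 Ω \ W))
    (hreal : ∀ p ∈ W, p.2 ≠ 0) : W = ∅ := by
  set A : Set (Fin n → Oct) := {q | ∃ p ∈ W, q = aff p.1 p.2 I} with hA
  let conj : (Fin n → ℝ) × (Fin n → ℝ) → (Fin n → ℝ) × (Fin n → ℝ) := fun p => (p.1, -p.2)
  have hconj : Continuous conj := by fun_prop
  have hV : IsOpen (s1 Ω) := isOpen_s1 hΩ.1 hax hI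
  have trace_self : ∀ p, aff p.1 p.2 I ∈ A ↔ p ∈ W := fun p => by
    refine ⟨fun ⟨p', hp', e⟩ => ?_, fun h => ⟨p, h, rfl⟩⟩
    obtain ⟨h1, h2 | ⟨-, h2⟩ | ⟨h2, -⟩⟩ := eq_of_aff_eq_aff hI hI e
    · exact absurd h2 (hreal p' hp')
    · rwa [show p = p' from Prod.ext h1 h2]
    · exact absurd h2 (ne_neg_of_mem_Sph hI)
  have trace_neg : ∀ p, aff p.1 p.2 (-I) ∈ A ↔ conj p ∈ W := fun p => by
    rw [aff_neg]
    exact trace_self (conj p)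
  have trace_other : ∀ J ∈ Sph, J ≠ I → J ≠ -I → ∀ x y, aff x y J ∉ A := by
    rintro J hJ h1 h2 x y ⟨p', hp', e⟩
    obtain ⟨-, h | ⟨h, -⟩ | ⟨h, -⟩⟩ := eq_of_aff_eq_aff hI hJ e
    exacts [hreal p' hp' h, h1 h, h2 h]
  have hAo : IsOpen[τs n] A := by
    refine isOpen_τs_iff.2 fun J hJ => ?_
    by_cases h1 : J = I
    · subst h1
      exact (Set.ext trace_self : {p | aff p.1 p.2 J ∈ A} = W) ▸ hW
    by_cases h2 : J = -I
    · subst h2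
      exact (Set.ext trace_neg : {p | aff p.1 p.2 (-I) ∈ A} = conj ⁻¹' W) ▸ hW.preimage hconj
    · simp only [trace_other J hJ h1 h2]
      exact isOpen_empty
  have hBo : IsOpen[τs n] (Ω \ A) := by
    refine isOpen_τs_iff.2 fun J hJ => ?_
    by_cases h1 : J = I
    · subst h1
      have : {p : (Fin n → ℝ) × (Fin n → ℝ) | aff p.1 p.2 J ∈ Ω \ A} = s1 Ω \ W := by
        rw [← setOf_aff_mem_eq_s1 hax hI]
        exact Set.ext fun p => and_congr_right' (not_congr (trace_self p))
      rwa [this]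
    by_cases h2 : J = -I
    · subst h2
      have : {p : (Fin n → ℝ) × (Fin n → ℝ) | aff p.1 p.2 (-I) ∈ Ω \ A} =
          conj ⁻¹' (s1 Ω \ W) := by
        rw [← setOf_aff_mem_eq_s1 hax hI]
        refine Set.ext fun p => and_congr ?_ (not_congr (trace_neg p))
        rw [aff_neg]
        rfl
      rw [this]
      exact hd.preimage hconj
    · have : {p : (Fin n → ℝ) × (Fin n → ℝ) | aff p.1 p.2 J ∈ Ω \ A} = s1 Ω := by
        rw [← setOf_aff_mem_eq_s1 hax hJ]
        exact Set.ext fun p => and_iff_left (trace_other J hJ h1 h2 _ _)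
      rwa [this]
  obtain ⟨J, hJ, h1, h2⟩ := exists_mem_Sph_ne I
  by_contra hne
  obtain ⟨p, hp⟩ := Set.nonempty_iff_ne_empty.2 hne
  have hpΩ : ∀ K ∈ Sph, aff p.1 p.2 K ∈ Ω := fun K hK => by
    have := hWΩ hp
    rwa [← setOf_aff_mem_eq_s1 hax hK] at this
  obtain ⟨q, -, hqA, -, hqB⟩ := hΩ.2.2 A (Ω \ A) hAo hBo
    (fun q hq => (em (q ∈ A)).imp id fun h => ⟨hq, h⟩)
    ⟨_, hpΩ I hI, (trace_self p).2 hp⟩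
    ⟨_, hpΩ J hJ, hpΩ J hJ, trace_other J hJ h1 h2 _ _⟩
  exact hqB hqA

section Identity

variable {E : Type*} [NormedAddCommGroup E] [NormedSpace ℝ E]

theorem eqOn_zero_of_frequently_eq_zero {T : E →L[ℝ] E} (hT : ∀ v, T (T v) = -v) {U : Set ℂ}
    (hU : IsOpen U) (hUc : IsPreconnected U) {h : ℂ → E} (hh : DifferentiableOn ℝ h U)
    (hcr : ∀ z ∈ U, fderiv ℝ h z Complex.I = T (fderiv ℝ h z 1)) {z₀ : ℂ} (hz₀ : z₀ ∈ U)
    (hf : ∃ᶠ z in 𝓝[≠] z₀, h z = 0) : Set.EqOn h 0 U := by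
  intro w hw
  refine (SeparatingDual.eq_zero_iff_forall_dual_eq_zero (R := ℝ) (h w)).2 fun φ => ?_
  set H : ℂ → ℂ := fun z => (φ (h z) : ℂ) - Complex.I * (φ (T (h z)) : ℂ) with hH
  have hd : ∀ z ∈ U, DifferentiableAt ℂ H z := by
    intro z hz
    have hz' : HasFDerivAt h (fderiv ℝ h z) z :=
      ((hh z hz).differentiableAt (hU.mem_nhds hz)).hasFDerivAt
    have h1 : HasFDerivAt (fun z => (φ (h z) : ℂ))
        ((Complex.ofRealCLM.comp φ).comp (fderiv ℝ h z)) z :=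
      ((Complex.ofRealCLM.comp φ).hasFDerivAt).comp z hz'
    have h2 : HasFDerivAt (fun z => (φ (T (h z)) : ℂ))
        ((Complex.ofRealCLM.comp (φ.comp T)).comp (fderiv ℝ h z)) z :=
      ((Complex.ofRealCLM.comp (φ.comp T)).hasFDerivAt).comp z hz'
    have h3 : HasFDerivAt H _ z := h1.sub (h2.const_mul Complex.I)
    refine differentiableAt_complex_iff_differentiableAt_real.2 ⟨h3.differentiableAt, ?_⟩
    rw [h3.fderiv]
    simp [hcr z hz, hT]
    linear_combination (φ (T (fderiv ℝ h z 1)) : ℂ) * Complex.I_sq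
  have han : AnalyticOnNhd ℂ H U :=
    DifferentiableOn.analyticOnNhd (fun z hz => (hd z hz).differentiableWithinAt) hU
  have h0 := han.eqOn_zero_of_preconnected_of_frequently_eq_zero hUc hz₀
    (hf.mono fun z hz => by simp [hH, hz])
  simpa [hH] using congrArg Complex.re (h0 hw)

variable {n : ℕ}

/-- The complex line through `q` with direction `w`, where `ℝⁿ × ℝⁿ` is read as `ℂⁿ`. -/
def complexLine (q w : (Fin n → ℝ) × (Fin n → ℝ)) (z : ℂ) : (Fin n → ℝ) × (Fin n → ℝ) :=
  q + (z.re • w + z.im • (-w.2, w.1))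

def complexDirection (w : (Fin n → ℝ) × (Fin n → ℝ)) :
    ℂ →L[ℝ] (Fin n → ℝ) × (Fin n → ℝ) :=
  Complex.reCLM.smulRight w + Complex.imCLM.smulRight (-w.2, w.1)

theorem complexLine_eq (q w : (Fin n → ℝ) × (Fin n → ℝ)) (z : ℂ) :
    complexLine q w z = q + complexDirection w z := by
  simp [complexLine, complexDirection]

/-- The Cauchy–Riemann equations for a complex structure `T` on the target. -/
def CauchyRiemann (T : E →L[ℝ] E) (g : (Fin n → ℝ) × (Fin n → ℝ) → E)
    (V : Set ((Fin n → ℝ) × (Fin n → ℝ))) : Prop :=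
  ∀ p ∈ V, ∀ m : Fin n,
    fderiv ℝ g p (Pi.single m 1, 0) + T (fderiv ℝ g p (0, Pi.single m 1)) = 0

theorem map_rotate_eq {T : E →L[ℝ] E} (hT : ∀ v, T (T v) = -v)
    {L : (Fin n → ℝ) × (Fin n → ℝ) →L[ℝ] E}
    (hL : ∀ m : Fin n, L (Pi.single m 1, 0) + T (L (0, Pi.single m 1)) = 0)
    (w : (Fin n → ℝ) × (Fin n → ℝ)) : L (-w.2, w.1) = T (L w) := by
  have key : ∀ u : Fin n → ℝ, L (u, 0) = - T (L (0, u)) := by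
    have : (L.comp (ContinuousLinearMap.inl ℝ _ _)).toLinearMap =
        (-(T.comp (L.comp (ContinuousLinearMap.inr ℝ _ _)))).toLinearMap := by
      refine LinearMap.pi_ext' fun m => LinearMap.ext_ring ?_
      simpa using eq_neg_of_add_eq_zero_left (hL m)
    exact fun u => by simpa using congrArg (fun A => A u) this
  have e1 : L (-w.2, w.1) = -L (w.2, 0) + L (0, w.1) := by
    rw [← map_neg, ← map_add]; simp
  have e2 : L w = L (w.1, 0) + L (0, w.2) := by
    rw [← map_add]; simp
  rw [e1, e2, key w.2, map_add, key w.1, map_neg, hT]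
  abel

theorem complexLine_eq_zero {T : E →L[ℝ] E} (hT : ∀ v, T (T v) = -v)
    {V : Set ((Fin n → ℝ) × (Fin n → ℝ))} {g : (Fin n → ℝ) × (Fin n → ℝ) → E}
    (hg : DifferentiableOn ℝ g V) (hcr : CauchyRiemann T g V)
    {B : Set ((Fin n → ℝ) × (Fin n → ℝ))} (hBo : IsOpen B) (hBc : Convex ℝ B) (hBV : B ⊆ V)
    {q w : (Fin n → ℝ) × (Fin n → ℝ)} (hq : q ∈ B)
    (hf : ∃ᶠ z in 𝓝[≠] (0 : ℂ), g (complexLine q w z) = 0) {z : ℂ}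
    (hz : complexLine q w z ∈ B) : g (complexLine q w z) = 0 := by
  have hline : ∀ z, HasFDerivAt (complexLine q w) (complexDirection w) z := fun z => by
    rw [show complexLine q w = fun z => q + complexDirection w z from
      funext (complexLine_eq q w)]
    exact (complexDirection w).hasFDerivAt.const_add q
  have hgd : ∀ p ∈ B, HasFDerivAt g (fderiv ℝ g p) p := fun p hp =>
    ((hg.mono hBV p hp).differentiableAt (hBo.mem_nhds hp)).hasFDerivAt
  have hcomp : ∀ z ∈ complexLine q w ⁻¹' B, HasFDerivAt (fun z => g (complexLine q w z))
      ((fderiv ℝ g (complexLine q w z)).comp (complexDirection w)) z := fun z hz =>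
    (hgd _ hz).comp z (hline z)
  have hopen : IsOpen (complexLine q w ⁻¹' B) :=
    hBo.preimage (continuous_iff_continuousAt.2 fun z => (hline z).continuousAt)
  have hconv : Convex ℝ (complexLine q w ⁻¹' B) := by
    rw [show complexLine q w = fun z => q + complexDirection w z from
      funext (complexLine_eq q w)]
    exact (hBc.translate_preimage_right q).linear_preimage (complexDirection w).toLinearMap
  refine eqOn_zero_of_frequently_eq_zero hT hopen hconv.isPreconnected
    (fun z hz => (hcomp z hz).differentiableAt.differentiableWithinAt) (fun z hz => ?_)
    (by simpa [complexLine] using hq) hf hz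
  rw [(hcomp z hz).fderiv]
  have := map_rotate_eq hT (hcr _ (hBV hz)) w
  simpa [complexDirection] using this

/-- A function satisfying the Cauchy–Riemann equations and vanishing at the real points vanishes
near every real point. -/
theorem eventually_eq_zero_of_real {T : E →L[ℝ] E} (hT : ∀ v, T (T v) = -v)
    {V : Set ((Fin n → ℝ) × (Fin n → ℝ))} (hV : IsOpen V)
    {g : (Fin n → ℝ) × (Fin n → ℝ) → E} (hg : DifferentiableOn ℝ g V)
    (hcr : CauchyRiemann T g V) (h0 : ∀ x, (x, 0) ∈ V → g (x, 0) = 0)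
    {x₀ : Fin n → ℝ} (hx₀ : (x₀, 0) ∈ V) : ∀ᶠ p in 𝓝 (x₀, 0), g p = 0 := by
  obtain ⟨r, hr, hB⟩ := Metric.isOpen_iff.1 hV _ hx₀
  filter_upwards [Metric.ball_mem_nhds _ hr] with p hp
  have hq : (p.1, (0 : Fin n → ℝ)) ∈ Metric.ball (x₀, (0 : Fin n → ℝ)) r := by
    rw [Metric.mem_ball, Prod.dist_eq] at hp ⊢
    simpa [hr] using (max_lt_iff.1 hp).1
  have hp' : complexLine (p.1, 0) (p.2, 0) Complex.I = p := by simp [complexLine]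
  have hcont : Continuous fun t : ℝ => (p.1 + t • p.2, (0 : Fin n → ℝ)) := by fun_prop
  have hreal : ∀ᶠ t : ℝ in 𝓝[≠] 0, g (complexLine (p.1, 0) (p.2, 0) (t : ℂ)) = 0 := by
    refine Filter.Eventually.filter_mono nhdsWithin_le_nhds ?_
    filter_upwards [hcont.continuousAt.preimage_mem_nhds
      (hV.mem_nhds (by simpa using hB hq))] with t ht
    simpa [complexLine] using h0 _ ht
  have htend : Filter.Tendsto (fun t : ℝ => (t : ℂ)) (𝓝[≠] 0) (𝓝[≠] 0) := by
    refine tendsto_nhdsWithin_iff.2 ⟨?_, ?_⟩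
    · exact (Complex.continuous_ofReal.tendsto' 0 0 (by simp)).mono_left nhdsWithin_le_nhds
    · filter_upwards [self_mem_nhdsWithin] with t ht
      simpa using ht
  rw [← hp']
  exact complexLine_eq_zero hT hg hcr Metric.isOpen_ball (convex_ball _ _) hB hq
    (htend.frequently hreal.frequently) (by rwa [hp'])

/-- The points of `V` near which a function satisfying the Cauchy–Riemann equations does not vanish
identically form an open set. -/
theorem isOpen_diff_interior_zero {T : E →L[ℝ] E} (hT : ∀ v, T (T v) = -v)
    {V : Set ((Fin n → ℝ) × (Fin n → ℝ))} (hV : IsOpen V)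
    {g : (Fin n → ℝ) × (Fin n → ℝ) → E} (hg : DifferentiableOn ℝ g V)
    (hcr : CauchyRiemann T g V) : IsOpen (V \ interior {p | g p = 0}) := by
  refine Metric.isOpen_iff.2 fun p hp => ?_
  obtain ⟨r, hr, hB⟩ := Metric.isOpen_iff.1 hV _ hp.1
  refine ⟨r, hr, fun q hq => ⟨hB hq, fun hqz => hp.2 ?_⟩⟩
  refine mem_interior_iff_mem_nhds.2 ?_
  filter_upwards [Metric.ball_mem_nhds p hr] with w hw
  have hw' : complexLine q (w - q) 1 = w := by simp [complexLine]
  have hcont : Continuous (complexLine q (w - q)) := by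
    simp only [funext (complexLine_eq q (w - q))]
    fun_prop
  have hev : ∀ᶠ z in 𝓝[≠] (0 : ℂ), g (complexLine q (w - q) z) = 0 := by
    refine Filter.Eventually.filter_mono nhdsWithin_le_nhds ?_
    have h0 : complexLine q (w - q) 0 = q := by simp [complexLine]
    exact hcont.continuousAt.eventually (p := fun p => g p = 0)
      (by rw [h0]; exact mem_interior_iff_mem_nhds.1 hqz)
  change g w = 0
  rw [← hw']
  exact complexLine_eq_zero hT hg hcr Metric.isOpen_ball (convex_ball _ _) hB hq
    hev.frequently (by rwa [hw'])

end Identity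
/-- A function that is holomorphic on a slice of an axially symmetric slice-domain and vanishes at
the real points vanishes identically. -/
theorem eqOn_zero_of_real {n : ℕ} {E : Type*} [NormedAddCommGroup E] [NormedSpace ℝ E]
    {T : E →L[ℝ] E} (hT : ∀ v, T (T v) = -v) {Ω : Set (Fin n → Oct)}
    (hΩ : SliceDomain n Ω) (hax : AxSymm n Ω)
    {g : (Fin n → ℝ) × (Fin n → ℝ) → E} (hg : DifferentiableOn ℝ g (s1 Ω))
    (hcr : CauchyRiemann T g (s1 Ω)) (h0 : ∀ x, (x, 0) ∈ s1 Ω → g (x, 0) = 0) :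
    Set.EqOn g 0 (s1 Ω) := by
  obtain ⟨I, hI, -⟩ := exists_mem_Sph_ne 0
  have hV : IsOpen (s1 Ω) := isOpen_s1 hΩ.1 hax hI
  have hempty := eq_empty_of_relatively_clopen hΩ hax hI
    (isOpen_diff_interior_zero hT hV hg hcr) Set.sdiff_subset
    (by rw [Set.sdiff_sdiff_right_self]; exact hV.inter isOpen_interior)
    (by
      rintro ⟨x, y⟩ ⟨hp, hp'⟩ (rfl : y = 0)
      exact hp' (mem_interior_iff_mem_nhds.2 (eventually_eq_zero_of_real hT hV hg hcr h0 hp)))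
  exact fun p hp => show g p = 0 from interior_subset (s := {p | g p = 0}) (Set.sdiff_eq_empty.1 hempty hp)

/-- The stem map determined by the values `a` and `b` of a function on the slices
of `I` and `-I`. -/
def stemOf {n : ℕ} (I : Oct) (a b : (Fin n → ℝ) × (Fin n → ℝ) → Oct)
    (p : (Fin n → ℝ) × (Fin n → ℝ)) : Oct × Oct :=
  ((2⁻¹ : ℝ) • (a p + b p), -((2⁻¹ : ℝ) • mulLeft I (a p - b p)))

theorem hasFDerivAt_stemOf {n : ℕ} (I : Oct) {a b : (Fin n → ℝ) × (Fin n → ℝ) → Oct}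
    {p : (Fin n → ℝ) × (Fin n → ℝ)} (ha : DifferentiableAt ℝ a p)
    (hb : DifferentiableAt ℝ b p) :
    HasFDerivAt (stemOf I a b)
      (((2⁻¹ : ℝ) • (fderiv ℝ a p + fderiv ℝ b p)).prod
        (-((2⁻¹ : ℝ) • (mulLeft I).comp (fderiv ℝ a p - fderiv ℝ b p)))) p :=
  ((ha.hasFDerivAt.add hb.hasFDerivAt).const_smul (2⁻¹ : ℝ)).prodMk
    ((((mulLeft I).hasFDerivAt.comp p
      (ha.hasFDerivAt.sub hb.hasFDerivAt)).const_smul (2⁻¹ : ℝ)).neg)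

theorem contDiffOn_stemOf {n : ℕ} (I : Oct) {a b : (Fin n → ℝ) × (Fin n → ℝ) → Oct}
    {V : Set ((Fin n → ℝ) × (Fin n → ℝ))} (ha : ContDiffOn ℝ 1 a V) (hb : ContDiffOn ℝ 1 b V) :
    ContDiffOn ℝ 1 (stemOf I a b) V :=
  ((ha.add hb).const_smul (2⁻¹ : ℝ)).prodMk
    (((mulLeft I).contDiff.comp_contDiffOn (ha.sub hb)).const_smul (2⁻¹ : ℝ)).neg

theorem stemOf_cauchyRiemann {n : ℕ} {I : Oct} (hI : I ∈ Sph)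
    {a b : (Fin n → ℝ) × (Fin n → ℝ) → Oct} {V : Set ((Fin n → ℝ) × (Fin n → ℝ))}
    (hV : IsOpen V) (ha : Holo n I a V) (hb : Holo n (-I) b V) :
    ∀ p ∈ V, ∀ m : Fin n, fderiv ℝ (stemOf I a b) p (Pi.single m 1, 0) +
      sigma2 (fderiv ℝ (stemOf I a b) p (0, Pi.single m 1)) = 0 := by
  intro p hp m
  have had := (ha.1.contDiffAt (hV.mem_nhds hp)).differentiableAt one_ne_zero
  have hbd := (hb.1.contDiffAt (hV.mem_nhds hp)).differentiableAt one_ne_zero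
  rw [(hasFDerivAt_stemOf I had hbd).fderiv]
  have e1 := eq_neg_of_add_eq_zero_left (ha.2 p hp m)
  have e2 := eq_neg_of_add_eq_zero_left (hb.2 p hp m)
  rw [neg_mul_eq, neg_neg, ← mulLeft_apply] at e2
  rw [← mulLeft_apply] at e1
  have hsq : ∀ q, mulLeft I (mulLeft I q) = -q := mul_mul_of_mem_Sph hI
  refine Prod.ext ?_ ?_
  · simp only [sigma2, ContinuousLinearMap.prod_apply, Prod.fst_add, Prod.fst_zero,
      smul_apply, add_apply, neg_apply,
      ContinuousLinearMap.comp_apply, sub_apply, e1, e2, map_sub]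
    module
  · simp only [sigma2, ContinuousLinearMap.prod_apply, Prod.snd_add, Prod.snd_zero,
      smul_apply, add_apply, neg_apply,
      ContinuousLinearMap.comp_apply, sub_apply, e1, e2, map_sub, map_neg, hsq]
    module

/-- The function induced on the slice of `I` by a holomorphic stem map is holomorphic. -/
theorem holo_of_stem {n : ℕ} {I : Oct} (hI : I ∈ Sph)
    {F : (Fin n → ℝ) × (Fin n → ℝ) → Oct × Oct} {V : Set ((Fin n → ℝ) × (Fin n → ℝ))}
    (hV : IsOpen V) (hF : ContDiffOn ℝ 1 F V)
    (hcr : ∀ p ∈ V, ∀ m : Fin n,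
      fderiv ℝ F p (Pi.single m 1, 0) + sigma2 (fderiv ℝ F p (0, Pi.single m 1)) = 0) :
    Holo n I (fun p => (F p).1 + mulLeft I (F p).2) V := by
  refine ⟨hF.fst.add ((mulLeft I).contDiff.comp_contDiffOn hF.snd), fun p hp m => ?_⟩
  have hd := ((hF.contDiffAt (hV.mem_nhds hp)).differentiableAt one_ne_zero).hasFDerivAt
  have hd' : HasFDerivAt (fun p => (F p).1 + mulLeft I (F p).2) _ p :=
    hd.fst.add ((mulLeft I).hasFDerivAt.comp p hd.snd)
  rw [hd'.fderiv, ← mulLeft_apply]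
  have hsq : ∀ q, mulLeft I (mulLeft I q) = -q := mul_mul_of_mem_Sph hI
  have e := eq_neg_of_add_eq_zero_left (hcr p hp m)
  simp [e, sigma2, hsq, -mulLeft_apply]

theorem weak_of_strong {n : ℕ} {Ω : Set (Fin n → Oct)} (hΩ : SliceOpen n Ω) (hax : AxSymm n Ω)
    {f : (Fin n → Oct) → Oct} (hf : SSliceReg n Ω f) : WSliceReg n Ω f := by
  obtain ⟨F, ⟨U, G, hU, hVU, hGF, hG, hcr⟩, hfF⟩ := hf
  intro I hI
  rw [setOf_aff_mem_eq_s1 hax hI]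
  have hV : IsOpen (s1 Ω) := isOpen_s1 hΩ hax hI
  have hholo := holo_of_stem hI hV (hG.mono hVU) fun p hp => hcr p (hVU hp)
  have heq : Set.EqOn (fun p => f (aff p.1 p.2 I)) (fun p => (G p).1 + mulLeft I (G p).2)
      (s1 Ω) := fun p hp => by
    simp only [hGF hp, mulLeft_apply]
    exact hfF p.1 p.2 I hI (by rwa [← setOf_aff_mem_eq_s1 hax hI] at hp)
  refine ⟨hholo.1.congr heq, fun p hp m => ?_⟩
  rw [(heq.eventuallyEq_of_mem (hV.mem_nhds hp)).fderiv_eq]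
  exact hholo.2 p hp m

theorem Holo.sub {n : ℕ} {I : Oct} {g h : (Fin n → ℝ) × (Fin n → ℝ) → Oct}
    {V : Set ((Fin n → ℝ) × (Fin n → ℝ))} (hV : IsOpen V) (hg : Holo n I g V)
    (hh : Holo n I h V) : Holo n I (fun p => g p - h p) V := by
  refine ⟨hg.1.sub hh.1, fun p hp m => ?_⟩
  have h1 := (hg.1.contDiffAt (hV.mem_nhds hp)).differentiableAt one_ne_zero
  have h2 := (hh.1.contDiffAt (hV.mem_nhds hp)).differentiableAt one_ne_zero
  have h3 := hg.2 p hp m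
  have h4 := hh.2 p hp m
  rw [← mulLeft_apply] at h3 h4 ⊢
  rw [fderiv_fun_sub h1 h2, sub_apply, sub_apply, map_sub, sub_add_sub_comm, h3, h4, sub_zero]

/-- Two functions that are holomorphic on a slice of an axially symmetric slice-domain and agree at
the real points are equal. -/
theorem Holo.eqOn_of_real {n : ℕ} {I : Oct} (hI : I ∈ Sph) {Ω : Set (Fin n → Oct)}
    (hΩ : SliceDomain n Ω) (hax : AxSymm n Ω) {g h : (Fin n → ℝ) × (Fin n → ℝ) → Oct}
    (hg : Holo n I g (s1 Ω)) (hh : Holo n I h (s1 Ω))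
    (h0 : ∀ x, (x, 0) ∈ s1 Ω → g (x, 0) = h (x, 0)) : Set.EqOn g h (s1 Ω) := by
  have hT : ∀ v, mulLeft I (mulLeft I v) = -v := mul_mul_of_mem_Sph hI
  have hsub := hg.sub (isOpen_s1 hΩ.1 hax hI) hh
  have := eqOn_zero_of_real hT hΩ hax (hsub.1.differentiableOn one_ne_zero) hsub.2
    fun x hx => sub_eq_zero.2 (h0 x hx)
  exact fun p hp => sub_eq_zero.1 (this hp)

theorem strong_of_weak {n : ℕ} {Ω : Set (Fin n → Oct)} (hΩ : SliceDomain n Ω)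
    (hax : AxSymm n Ω) {f : (Fin n → Oct) → Oct} (hf : WSliceReg n Ω f) : SSliceReg n Ω f := by
  obtain ⟨J, hJ, -⟩ := exists_mem_Sph_ne 0
  have hV : IsOpen (s1 Ω) := isOpen_s1 hΩ.1 hax hJ
  have hholo : ∀ I ∈ Sph, Holo n I (fun p => f (aff p.1 p.2 I)) (s1 Ω) := fun I hI => by
    have := hf I hI
    rwa [setOf_aff_mem_eq_s1 hax hI] at this
  have ha := hholo J hJ
  have hb := hholo (-J) (neg_mem_Sph hJ)
  have hcr := stemOf_cauchyRiemann hJ hV ha hb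
  have hC := contDiffOn_stemOf J ha.1 hb.1
  refine ⟨_, ⟨s1 Ω, _, hV, subset_rfl, Set.eqOn_refl _ _, hC, hcr⟩, ?_⟩
  intro x y I hI hxy
  refine (hholo I hI).eqOn_of_real hI hΩ hax (holo_of_stem hI hV hC hcr) (fun x _ => ?_)
    (show (x, y) ∈ s1 Ω from ⟨I, hI, hxy⟩)
  simp only [stemOf, aff_zero x J I, aff_zero x (-J) I, sub_self, map_zero, smul_zero, neg_zero,
    add_zero]
  module

/-- On an axially symmetric slice-domain, a function is weak
slice regular iff it is strong slice regular. -/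
theorem weak_iff_strong_slice_regular (n : ℕ) (hn : 1 ≤ n)
    (Ω : Set (Fin n → Oct)) (hΩ : SliceDomain n Ω) (hax : AxSymm n Ω)
    (f : (Fin n → Oct) → Oct) :
    WSliceReg n Ω f ↔ SSliceReg n Ω f := by
  exact ⟨strong_of_weak hΩ hax, weak_of_strong hΩ.1 hax⟩

end
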